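/- Assume the families B and (G,B) satisfy positivity and that A_k ⊥⊥ G_k | B_k for every k = 0,…,p. With s_k := b_{a_k}((G,B)) − b_{a_k}(B) and r_k := [I_{ā_{k−1}}(Ā_{k−1}) / λ_{ā_{k−1}}(B̄_{k−1})] · (1_{{A_k = a_k}} / π_{a_k}(B_k) − 1) · s_k, one has E[r_k] = 0 for every k = 0,…,p. (Zero-mean property of the residual terms in the proof of Lemma 4.1.) -/

import Mathlib

open MeasureTheory ProbabilityTheory

noncomputable section

/-- The σ-algebra generated by a set of real-valued random variables. -/
def genSig {Ω : Type*} (S : Set (Ω → ℝ)) : MeasurableSpace Ω :=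
  ⨆ f ∈ S, MeasurableSpace.comap f (inferInstance : MeasurableSpace ℝ)

/-- Indicator `1_{A = a}` of the event that the random variable `A` takes the value `a`. -/
def ind {Ω : Type*} (A : Ω → ℝ) (a : ℝ) : Ω → ℝ := fun ω => if A ω = a then 1 else 0

/-- `I_{ā_{k-1}}(Ā_{k-1}) = ∏_{j<k} 1_{A_j = a_j}` (equal to `1` when `k = 0`). -/
def indUpto {Ω : Type*} (A : ℕ → Ω → ℝ) (a : ℕ → ℝ) (k : ℕ) : Ω → ℝ :=
  fun ω => ∏ j ∈ Finset.range k, ind (A j) (a j) ω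

variable {Ω : Type*} [MeasurableSpace Ω]

/-- Propensity `π_{a_k}(Z_k) = E[1_{A_k = a_k} ∣ σ(Z_k)]`. -/
def propen (μ : Measure Ω) (A : ℕ → Ω → ℝ) (a : ℕ → ℝ) (Z : ℕ → Set (Ω → ℝ)) (k : ℕ) : Ω → ℝ :=
  μ[ind (A k) (a k) | genSig (Z k)]

/-- Cumulative weight `λ_{ā_{k-1}}(Z̄_{k-1}) = ∏_{j<k} π_{a_j}(Z_j)` (equal to `1` when `k = 0`). -/
def cumWeight (μ : Measure Ω) (A : ℕ → Ω → ℝ) (a : ℕ → ℝ) (Z : ℕ → Set (Ω → ℝ)) (k : ℕ) :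
    Ω → ℝ :=
  fun ω => ∏ j ∈ Finset.range k, propen μ A a Z j ω

/-- The adjustment family `Z` satisfies positivity: the propensities are uniformly bounded away
from `0` almost surely, for every time `k = 0, …, p`. -/
def Positivity (μ : Measure Ω) (A : ℕ → Ω → ℝ) (a : ℕ → ℝ) (Z : ℕ → Set (Ω → ℝ)) (p : ℕ) :
    Prop :=
  ∃ c : ℝ, 0 < c ∧ ∀ k ≤ p, ∀ᵐ ω ∂μ, c ≤ propen μ A a Z k ω

/-- Auxiliary downward recursion: `bAux μ A a Y Z p n` is the iterated regression
`b_{a_{p-n}}(Z)`. -/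
def bAux (μ : Measure Ω) (A : ℕ → Ω → ℝ) (a : ℕ → ℝ) (Y : Ω → ℝ) (Z : ℕ → Set (Ω → ℝ))
    (p : ℕ) : ℕ → Ω → ℝ
  | 0 => fun ω =>
      (μ[fun ω' => Y ω' * ind (A p) (a p) ω' | genSig (Z p)]) ω / propen μ A a Z p ω
  | n + 1 => fun ω =>
      (μ[fun ω' => bAux μ A a Y Z p n ω' * ind (A (p - (n + 1))) (a (p - (n + 1))) ω' |
          genSig (Z (p - (n + 1)))]) ω / propen μ A a Z (p - (n + 1)) ω

/-- Iterated regression `b_{a_k}(Z)`, for `k = 0, …, p`. -/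
def breg (μ : Measure Ω) (A : ℕ → Ω → ℝ) (a : ℕ → ℝ) (Y : Ω → ℝ) (Z : ℕ → Set (Ω → ℝ))
    (p k : ℕ) : Ω → ℝ :=
  bAux μ A a Y Z p (p - k)

/-- `b_{a_{k-1}}(Z)` with the convention `b_{a_{-1}}(Z) = E[b_{a_0}(Z)]` (a constant). -/
def bregPrev (μ : Measure Ω) (A : ℕ → Ω → ℝ) (a : ℕ → ℝ) (Y : Ω → ℝ) (Z : ℕ → Set (Ω → ℝ))
    (p k : ℕ) : Ω → ℝ :=
  if k = 0 then fun _ => ∫ ω, breg μ A a Y Z p 0 ω ∂μ else breg μ A a Y Z p (k - 1)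

/-- The influence function `ψ_a(Z)`. -/
def psi (μ : Measure Ω) (A : ℕ → Ω → ℝ) (a : ℕ → ℝ) (Y : Ω → ℝ) (Z : ℕ → Set (Ω → ℝ))
    (p : ℕ) : Ω → ℝ := fun ω =>
  indUpto A a (p + 1) ω * (Y ω - breg μ A a Y Z p p ω) / cumWeight μ A a Z (p + 1) ω +
    ∑ k ∈ Finset.range (p + 1),
      indUpto A a k ω * (breg μ A a Y Z p k ω - bregPrev μ A a Y Z p k ω) /
        cumWeight μ A a Z k ω

end
section HelperLemmas

open Filter

variable {Ω : Type*}

lemma genSig_mono {S T : Set (Ω → ℝ)} (h : S ⊆ T) : genSig S ≤ genSig T :=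
  biSup_mono h

lemma genSig_union (S T : Set (Ω → ℝ)) : genSig (S ∪ T) = genSig S ⊔ genSig T :=
  iSup_union

lemma measurable_genSig {S : Set (Ω → ℝ)} {f : Ω → ℝ} (hf : f ∈ S) : Measurable[genSig S] f :=
  Measurable.mono (comap_measurable f)
    (le_iSup₂ (f := fun f (_ : f ∈ S) => MeasurableSpace.comap f inferInstance) f hf) le_rfl

lemma ind_eq_indicator (A : Ω → ℝ) (a : ℝ) :
    ind A a = (A ⁻¹' {a}).indicator fun _ => (1 : ℝ) := by
  classical
  ext ω
  simp [ind, Set.indicator_apply]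

lemma measurable_ind {m : MeasurableSpace Ω} {A : Ω → ℝ} (hA : Measurable A) (a : ℝ) :
    Measurable (ind A a) := by
  rw [ind_eq_indicator]
  exact measurable_const.indicator (hA (measurableSet_singleton a))

lemma integrable_ind {m : MeasurableSpace Ω} (μ : Measure Ω) [IsFiniteMeasure μ]
    {A : Ω → ℝ} (hA : Measurable A) (a : ℝ) : Integrable (ind A a) μ := by
  rw [ind_eq_indicator]
  exact (integrable_const _).indicator (hA (measurableSet_singleton a))

lemma measurable_propen [MeasurableSpace Ω] (μ : Measure Ω) (A : ℕ → Ω → ℝ) (a : ℕ → ℝ)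
    (Z : ℕ → Set (Ω → ℝ)) (k : ℕ) : Measurable[genSig (Z k)] (propen μ A a Z k) :=
  stronglyMeasurable_condExp.measurable

lemma measurable_breg [MeasurableSpace Ω] (μ : Measure Ω) (A : ℕ → Ω → ℝ) (a : ℕ → ℝ)
    (Y : Ω → ℝ) (Z : ℕ → Set (Ω → ℝ)) {p k : ℕ} (hk : k ≤ p) :
    Measurable[genSig (Z k)] (breg μ A a Y Z p k) := by
  obtain ⟨n, rfl⟩ := Nat.exists_eq_add_of_le hk
  unfold breg
  rw [Nat.add_sub_cancel_left]
  cases n with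
  | zero => exact stronglyMeasurable_condExp.measurable.div (measurable_propen μ A a Z k)
  | succ n =>
    have h : k + (n + 1) - (n + 1) = k := by omega
    simp only [bAux, h]
    exact stronglyMeasurable_condExp.measurable.div (measurable_propen μ A a Z k)

/-- The σ-algebra `m₁ ⊔ m₂` is generated by the π-system of intersections. -/
lemma sup_eq_generateFrom_inter (m₁ m₂ : MeasurableSpace Ω) :
    m₁ ⊔ m₂ = MeasurableSpace.generateFrom
      (Set.image2 (· ∩ ·) {u | MeasurableSet[m₁] u} {v | MeasurableSet[m₂] v}) := by
  apply le_antisymm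
  · refine sup_le (fun u hu => ?_) fun v hv => ?_
    · exact MeasurableSpace.measurableSet_generateFrom
        ⟨u, hu, Set.univ, @MeasurableSet.univ _ m₂, Set.inter_univ u⟩
    · exact MeasurableSpace.measurableSet_generateFrom
        ⟨Set.univ, @MeasurableSet.univ _ m₁, v, hv, Set.univ_inter v⟩
  · refine MeasurableSpace.generateFrom_le ?_
    rintro _ ⟨u, hu, v, hv, rfl⟩
    exact @MeasurableSet.inter _ (m₁ ⊔ m₂) _ _ (le_sup_left (a := m₁) _ hu)
      (le_sup_right (b := m₂) _ hv)

lemma isPiSystem_image2_inter (m₁ m₂ : MeasurableSpace Ω) :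
    IsPiSystem
      (Set.image2 (· ∩ ·) {u | MeasurableSet[m₁] u} {v | MeasurableSet[m₂] v}) := by
  rintro _ ⟨u, hu, v, hv, rfl⟩ _ ⟨u', hu', v', hv', rfl⟩ -
  exact ⟨u ∩ u', @MeasurableSet.inter _ m₁ _ _ hu hu', v ∩ v', @MeasurableSet.inter _ m₂ _ _ hv hv',
    Set.inter_inter_inter_comm u u' v v'⟩

/-- Conditioning on additional conditionally independent information does not change a
conditional probability. -/
lemma condExp_sup_ae_eq_of_condIndep {m' m₁ m₂ : MeasurableSpace Ω} [mΩ : MeasurableSpace Ω]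
    [StandardBorelSpace Ω] (hm' : m' ≤ mΩ) (hm₁ : m₁ ≤ mΩ) (hm₂ : m₂ ≤ mΩ)
    (μ : Measure Ω) [IsFiniteMeasure μ] (h : CondIndep m' m₁ m₂ hm' μ)
    {s : Set Ω} (hs : MeasurableSet[m₁] s) :
    μ[s.indicator (fun _ => (1 : ℝ)) | m' ⊔ m₂] =ᵐ[μ] μ[s.indicator (fun _ => (1 : ℝ)) | m'] := by
  rw [condIndep_iff m' m₁ m₂ hm' hm₁ hm₂] at h
  have hle : m' ⊔ m₂ ≤ mΩ := sup_le hm' hm₂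
  have hsint : Integrable (s.indicator fun _ => (1 : ℝ)) μ :=
    (integrable_const _).indicator (hm₁ s hs)
  set f : Ω → ℝ := s.indicator fun _ => (1 : ℝ) with hf
  have hfint : Integrable (μ[f | m']) μ := integrable_condExp
  have hsm : StronglyMeasurable[m'] (μ[f | m']) := stronglyMeasurable_condExp
  refine (ae_eq_condExp_of_forall_setIntegral_eq hle hsint (fun _ _ _ => hfint.integrableOn) ?_
    (hsm.mono (le_sup_left (a := m') (b := m₂))).aestronglyMeasurable).symm
  intro t ht _
  induction t, ht using MeasurableSpace.induction_on_inter
    (sup_eq_generateFrom_inter m' m₂) (isPiSystem_image2_inter m' m₂) with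
  | empty => simp
  | basic t ht =>
    obtain ⟨u, hu, v, hv, rfl⟩ := ht
    have hvm : MeasurableSet v := hm₂ v hv
    have hgint : Integrable (v.indicator fun _ => (1 : ℝ)) μ := (integrable_const _).indicator hvm
    have hmul : (fun ω => μ[f | m'] ω * v.indicator (fun _ => (1 : ℝ)) ω)
        = v.indicator (μ[f | m']) := by
      ext ω
      by_cases hω : ω ∈ v <;> simp [hω]
    have hmulint : Integrable (μ[f | m'] * v.indicator fun _ => (1 : ℝ)) μ := by
      change Integrable (fun ω => μ[f | m'] ω * v.indicator (fun _ => (1 : ℝ)) ω) μ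
      rw [hmul]
      exact hfint.indicator hvm
    have hpull : μ[μ[f | m'] * v.indicator (fun _ => (1 : ℝ)) | m'] =ᵐ[μ]
        μ[f | m'] * μ[v.indicator (fun _ => (1 : ℝ)) | m'] :=
      condExp_mul_of_stronglyMeasurable_left stronglyMeasurable_condExp hmulint hgint
    have hinter : v.indicator f = (s ∩ v).indicator fun _ => (1 : ℝ) := by
      rw [hf, Set.indicator_indicator, Set.inter_comm]
    have hum := hm' u hu
    calc ∫ ω in u ∩ v, μ[f | m'] ω ∂μ
        = ∫ ω in u, v.indicator (μ[f | m']) ω ∂μ := (setIntegral_indicator hvm).symm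
      _ = ∫ ω in u, (μ[f | m'] * v.indicator fun _ => (1 : ℝ)) ω ∂μ := by
          rw [← hmul]; rfl
      _ = ∫ ω in u, μ[μ[f | m'] * v.indicator (fun _ => (1 : ℝ)) | m'] ω ∂μ :=
          (setIntegral_condExp hm' hmulint hu).symm
      _ = ∫ ω in u, μ[(s ∩ v).indicator (fun _ => (1 : ℝ)) | m'] ω ∂μ :=
          integral_congr_ae (ae_restrict_of_ae (hpull.trans (h s v hs hv).symm))
      _ = ∫ ω in u, (s ∩ v).indicator (fun _ => (1 : ℝ)) ω ∂μ :=
          setIntegral_condExp hm' ((integrable_const _).indicator ((hm₁ s hs).inter hvm)) hu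
      _ = ∫ ω in u ∩ v, f ω ∂μ := by rw [← hinter, setIntegral_indicator hvm]
  | compl t ht ih =>
    have h₁ := integral_add_compl (hle t ht) hfint
    have h₂ := integral_add_compl (hle t ht) hsint
    have h₃ : ∫ ω, μ[f | m'] ω ∂μ = ∫ ω, f ω ∂μ := integral_condExp hm'
    have h₄ := ih (measure_lt_top μ t)
    linarith
  | iUnion g hd hg ih =>
    rw [integral_iUnion (fun i => hle _ (hg i)) hd hfint.integrableOn,
      integral_iUnion (fun i => hle _ (hg i)) hd hsint.integrableOn]
    exact tsum_congr fun i => ih i (measure_lt_top μ _)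

/-- A product of an `m`-measurable function and a function with zero conditional mean given `m`
integrates to zero. -/
lemma integral_mul_eq_zero_of_condExp_ae_eq_zero {m : MeasurableSpace Ω} [mΩ : MeasurableSpace Ω]
    (hm : m ≤ mΩ) (μ : Measure Ω) [IsFiniteMeasure μ] {H D : Ω → ℝ}
    (hH : StronglyMeasurable[m] H) (hD : Integrable D μ) (h : μ[D | m] =ᵐ[μ] 0) :
    ∫ ω, (H * D) ω ∂μ = 0 := by
  by_cases hHD : Integrable (H * D) μ
  · rw [← integral_condExp hm]
    refine integral_eq_zero_of_ae ?_
    filter_upwards [condExp_mul_of_stronglyMeasurable_left hH hHD hD, h] with ω h₁ h₂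
    simp [h₁, h₂]
  · exact integral_undef hHD

end HelperLemmas

/-- zero-mean property of the residual terms in the proof of Lemma 4.1.
Under positivity of `B` and `(G, B)` and `A_k ⊥⊥ G_k ∣ B_k` for all `k`, the residuals
`r_k` have mean zero for every `k = 0, …, p`. -/
theorem residual_mean_zero {Ω : Type*} [mΩ : MeasurableSpace Ω] [StandardBorelSpace Ω]
    (P : Measure Ω) [IsProbabilityMeasure P] (p : ℕ)
    (A : ℕ → Ω → ℝ) (hA : ∀ k, Measurable (A k))
    (hAfin : ∀ k, (Set.range (A k)).Finite)
    (Y : Ω → ℝ) (hYm : Measurable Y) (hYbd : ∃ C : ℝ, ∀ ω, |Y ω| ≤ C)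
    (a : ℕ → ℝ) (ha : ∀ k ≤ p, a k ∈ Set.range (A k))
    (K G B : ℕ → Set (Ω → ℝ)) (hKfin : ∀ k, (K k).Finite)
    (hGle : ∀ k, genSig (G k) ≤ mΩ) (hBle : ∀ k, genSig (B k) ≤ mΩ)
    (hdisj : ∀ k ≤ p, Disjoint (G k) (B k))
    (hcover : ∀ k ≤ p, G k ∪ B k = A '' Set.Iio k ∪ ⋃ j ∈ Set.Iic k, K j)
    (hBpos : Positivity P A a B p)
    (hGBpos : Positivity P A a (fun k => G k ∪ B k) p)
    (hCI : ∀ k ≤ p,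
      CondIndep (genSig (B k)) (MeasurableSpace.comap (A k) inferInstance) (genSig (G k))
        (hBle k) P) :
    ∀ k ≤ p,
      ∫ ω,
        (indUpto A a k ω / cumWeight P A a B k ω *
          (ind (A k) (a k) ω / propen P A a B k ω - 1) *
          (breg P A a Y (fun i => G i ∪ B i) p k ω - breg P A a Y B p k ω)) ∂P = 0 := by
  intro k hk
  have hm : genSig (G k ∪ B k) ≤ mΩ := by
    rw [genSig_union]
    exact sup_le (hGle k) (hBle k)
  have hBk : genSig (B k) ≤ genSig (G k ∪ B k) := genSig_mono Set.subset_union_right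
  have hBj : ∀ j < k, genSig (B j) ≤ genSig (G k ∪ B k) := by
    intro j hj
    refine genSig_mono (Set.subset_union_right.trans (?_ : G j ∪ B j ⊆ G k ∪ B k))
    rw [hcover j (hj.le.trans hk), hcover k hk]
    exact Set.union_subset_union (Set.image_mono (Set.Iio_subset_Iio hj.le))
      (Set.biUnion_subset_biUnion_left (Set.Iic_subset_Iic.2 hj.le))
  have hAj : ∀ j < k, Measurable[genSig (G k ∪ B k)] (A j) := by
    intro j hj
    refine measurable_genSig ?_
    rw [hcover k hk]
    exact Or.inl ⟨j, hj, rfl⟩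
  have hπ : Measurable[genSig (G k ∪ B k)] (propen P A a B k) :=
    (measurable_propen P A a B k).mono hBk le_rfl
  have hI : Measurable[genSig (G k ∪ B k)] (indUpto A a k) :=
    Finset.measurable_fun_prod _ fun j hj => measurable_ind (hAj j (Finset.mem_range.1 hj)) (a j)
  have hW : Measurable[genSig (G k ∪ B k)] (cumWeight P A a B k) :=
    Finset.measurable_fun_prod _ fun j hj =>
      (measurable_propen P A a B j).mono (hBj j (Finset.mem_range.1 hj)) le_rfl
  have hb₁ : Measurable[genSig (G k ∪ B k)] (breg P A a Y (fun i => G i ∪ B i) p k) :=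
    measurable_breg P A a Y (fun i => G i ∪ B i) hk
  have hb₂ : Measurable[genSig (G k ∪ B k)] (breg P A a Y B p k) :=
    (measurable_breg P A a Y B hk).mono hBk le_rfl
  have hint : Integrable (ind (A k) (a k)) P := integrable_ind P (hA k) (a k)
  have hπint : Integrable (propen P A a B k) P := integrable_condExp
  have hprop : P[ind (A k) (a k) | genSig (G k ∪ B k)] =ᵐ[P] propen P A a B k := by
    unfold propen
    rw [ind_eq_indicator, genSig_union, sup_comm]
    exact condExp_sup_ae_eq_of_condIndep (hBle k) (hA k).comap_le (hGle k) P (hCI k hk)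
      ⟨{a k}, measurableSet_singleton _, rfl⟩
  have hzero : P[ind (A k) (a k) - propen P A a B k | genSig (G k ∪ B k)] =ᵐ[P] 0 := by
    filter_upwards [condExp_sub hint hπint (genSig (G k ∪ B k)), hprop] with ω h₁ h₂
    rw [h₁, Pi.sub_apply, h₂, condExp_of_stronglyMeasurable hm hπ.stronglyMeasurable hπint]
    simp
  have hH : Measurable[genSig (G k ∪ B k)] fun ω =>
      indUpto A a k ω / cumWeight P A a B k ω / propen P A a B k ω *
        (breg P A a Y (fun i => G i ∪ B i) p k ω - breg P A a Y B p k ω) :=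
    ((hI.div hW).div hπ).mul (hb₁.sub hb₂)
  rw [← integral_mul_eq_zero_of_condExp_ae_eq_zero hm P hH.stronglyMeasurable
    (hint.sub hπint) hzero]
  refine integral_congr_ae ?_
  obtain ⟨c, hc, hcπ⟩ := hBpos
  filter_upwards [hcπ k hk] with ω hω
  have hne : propen P A a B k ω ≠ 0 := (hc.trans_le hω).ne'
  simp only [Pi.mul_apply, Pi.sub_apply]
  rw [div_sub_one hne]
  ring
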